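/- Let σ : [0,1] → ℂ be continuous with 0 ∉ σ '' [0,1] and σ 1 = −σ 0. Define γ : [0,1] → ℂ by γ t = σ(2t) for t ∈ [0,1/2] and γ t = −σ(2t − 1) for t ∈ [1/2,1]. Then γ is a continuous loop (γ 0 = γ 1) avoiding 0, and its winding number n(γ, 0) is an odd integer; in particular n(γ, 0) ≠ 0. -/

import Mathlib

open Set

/-- `IsWindingNumber γ z n` : the winding number of the loop `γ` about `z` is `n`,
expressed via logarithmic lifts: every continuous `ℓ` on `[0,1]` with
`γ t - z = exp (ℓ t)` satisfies `ℓ 1 - ℓ 0 = 2 π i n`. -/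
def IsWindingNumber (γ : ℝ → ℂ) (z : ℂ) (n : ℤ) : Prop :=
  ∀ ℓ : ℝ → ℂ, ContinuousOn ℓ (Set.Icc 0 1) →
    (∀ t ∈ Set.Icc (0:ℝ) 1, γ t - z = Complex.exp (ℓ t)) →
    ℓ 1 - ℓ 0 = 2 * Real.pi * Complex.I * n

lemma exp_const_aux (f : ℝ → ℂ) (hf : ContinuousOn f (Set.Icc 0 1))
    (h : ∀ t ∈ Set.Icc (0:ℝ) 1, Complex.exp (f t) = Complex.exp (f 0)) : f 1 = f 0 := by
  have := Complex.isCoveringMap_exp.eqOn_of_comp_eqOn (s := Set.Icc (0:ℝ) 1) (g₁ := f)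
    (g₂ := fun _ => f 0) isPreconnected_Icc hf continuousOn_const
    (fun t ht => Subtype.ext (h t ht)) (a := 0) (by simp) rfl
  exact this (by simp)

theorem stmt6 (σ : ℝ → ℂ) (hσ : ContinuousOn σ (Set.Icc 0 1))
    (h0 : (0:ℂ) ∉ σ '' Set.Icc 0 1) (hends : σ 1 = -σ 0)
    (γ : ℝ → ℂ)
    (hγ : ∀ t, γ t = if t ≤ 1/2 then σ (2*t) else -σ (2*t - 1)) :
    ContinuousOn γ (Set.Icc 0 1) ∧ γ 0 = γ 1 ∧ (0:ℂ) ∉ γ '' Set.Icc 0 1 ∧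
      ∃ n : ℤ, Odd n ∧ n ≠ 0 ∧ IsWindingNumber γ 0 n := by
  have hA : ∀ t, t ≤ 1/2 → γ t = σ (2*t) := fun t ht => by rw [hγ, if_pos ht]
  have hB : ∀ t, 1/2 ≤ t → γ t = -σ (2*t-1) := fun t ht => by
    rcases ht.eq_or_lt with rfl | ht
    · rw [hA _ le_rfl]; norm_num [hends]
    · rw [hγ, if_neg (not_le.2 ht)]
  refine ⟨?_, ?_, ?_, ?_⟩
  · have e : Set.Icc (0:ℝ) 1 = Set.Icc 0 (1/2) ∪ Set.Icc (1/2) 1 := by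
      rw [Set.Icc_union_Icc_eq_Icc] <;> norm_num
    rw [e]
    refine ContinuousOn.union_of_isClosed ?_ ?_ isClosed_Icc isClosed_Icc
    · refine ContinuousOn.congr (f := fun t => σ (2*t)) ?_ (fun t ht => hA t ht.2)
      refine hσ.comp (by fun_prop) (fun t ht => ?_)
      constructor <;> linarith [ht.1, ht.2]
    · refine ContinuousOn.congr (f := fun t => -σ (2*t-1)) ?_ (fun t ht => hB t ht.1)
      refine (hσ.comp (f := fun t => 2*t-1) (by fun_prop) (fun t ht => ?_)).neg
      constructor <;> linarith [ht.1, ht.2]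
  · rw [hA 0 (by norm_num), hB 1 (by norm_num)]; norm_num [hends]
  · rintro ⟨t, ht, h⟩
    rcases le_total t (1/2) with h' | h'
    · rw [hA t h'] at h
      exact h0 ⟨2*t, ⟨by linarith [ht.1], by linarith⟩, h⟩
    · rw [hB t h', neg_eq_zero] at h
      exact h0 ⟨2*t-1, ⟨by linarith, by linarith [ht.2]⟩, h⟩
  · by_cases hex : ∃ ℓ : ℝ → ℂ, ContinuousOn ℓ (Set.Icc 0 1) ∧
      (∀ t ∈ Set.Icc (0:ℝ) 1, γ t - 0 = Complex.exp (ℓ t))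
    swap
    · exact ⟨1, odd_one, one_ne_zero, fun ℓ h1 h2 => (hex ⟨ℓ, h1, h2⟩).elim⟩
    obtain ⟨ℓ, hc, hl⟩ := hex
    have hm : ∀ t ∈ Set.Icc (0:ℝ) 1,
        Complex.exp (ℓ ((t+1)/2) - ℓ (t/2)) = -1 := by
      intro t ht
      have hne : σ t ≠ 0 := fun h => h0 ⟨t, ht, h⟩
      rw [Complex.exp_sub, ← hl _ ⟨by linarith [ht.1], by linarith [ht.2]⟩,
        ← hl _ ⟨by linarith [ht.1], by linarith [ht.2]⟩, hA (t/2) (by linarith [ht.2]),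
        hB ((t+1)/2) (by linarith [ht.1]), show 2*(t/2) = t by ring,
        show 2*((t+1)/2)-1 = t by ring]
      field_simp
      simp
    have hmc : ContinuousOn (fun t : ℝ => ℓ ((t+1)/2) - ℓ (t/2)) (Set.Icc 0 1) := by
      refine (hc.comp (f := fun t => (t+1)/2) (by fun_prop) (fun t ht => ?_)).sub
        (hc.comp (f := fun t => t/2) (by fun_prop) (fun t ht => ?_))
      all_goals constructor <;> linarith [ht.1, ht.2]
    have key := exp_const_aux _ hmc (fun t ht => by rw [hm t ht, hm 0 (by simp)])
    have h1 := hm 0 (by simp)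
    rw [← Complex.exp_pi_mul_I, Complex.exp_eq_exp_iff_exists_int] at h1
    obtain ⟨k, hk⟩ := h1
    norm_num at hk key
    refine ⟨2*k+1, ⟨k, rfl⟩, by omega, fun ℓ' hc' hl' => ?_⟩
    have e2 := exp_const_aux _ (hc'.sub hc) (fun t ht => by
      have hz : ∀ s ∈ Set.Icc (0:ℝ) 1, Complex.exp ((ℓ' - ℓ) s) = 1 := fun s hs => by
        rw [Pi.sub_apply, Complex.exp_sub, ← hl' s hs, hl s hs, div_self (Complex.exp_ne_zero _)]
      exact (hz t ht).trans (hz 0 (by simp)).symm)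
    simp only [Pi.sub_apply] at e2
    push_cast
    linear_combination e2 + key + 2 * hk
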